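/- Let N ≥ 2 be an integer, let δ > 0 and C ≥ 1, and let λ_1, …, λ_N ∈ ℝ satisfy the (δ, C)-non-accumulation property. Fix an index i, let 0 < θ ≤ 1, and assume |λ_j − λ_i| ≥ θ/N for all j ≠ i. Then there exists a constant C' > 0 depending only on C and δ such that (1/N²)·Σ_{j ≠ i} 1/(λ_j − λ_i)² ≤ C'·N^{δ}·θ^{−2}. -/

import Mathlib

/-- The `(δ, C)`-non-accumulation property: every interval `I` of length `|I| ≥ N^{−1+δ}`
contains at most `C·|I|·N` of the points `λ_j`. -/
def NonAccum (N : ℕ) (δ C : ℝ) (lam : Fin N → ℝ) : Prop :=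
  ∀ a b : ℝ, a ≤ b → (N : ℝ) ^ (-1 + δ) ≤ b - a →
    ((Finset.univ.filter (fun j => a ≤ lam j ∧ lam j ≤ b)).card : ℝ) ≤ C * (b - a) * N

/-- Non-accumulation bounds the number of points within distance `R` of a given real. -/
lemma NonAccum.card_le {N : ℕ} {δ C : ℝ} {lam : Fin N → ℝ} (h : NonAccum N δ C lam) (x : ℝ)
    {R : ℝ} (hR : (N : ℝ) ^ (-1 + δ) ≤ R) :
    ((Finset.univ.filter (fun j => |lam j - x| ≤ R)).card : ℝ) ≤ 2 * C * R * N := by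
  have hr : (0 : ℝ) ≤ (N : ℝ) ^ (-1 + δ) := by positivity
  have key := h (x - R) (x + R) (by linarith) (by linarith)
  have hfilter : Finset.univ.filter (fun j => |lam j - x| ≤ R) =
      Finset.univ.filter (fun j => x - R ≤ lam j ∧ lam j ≤ x + R) := by
    ext j
    simp only [Finset.mem_filter, Finset.mem_univ, true_and, abs_le]
    constructor <;> rintro ⟨h₁, h₂⟩ <;> constructor <;> linarith
  rw [hfilter]
  linarith

/-- Doubling the radius of a truncated inverse-square sum costs at most the number of points in
the larger ball times the largest possible new term. -/
lemma sum_inv_sq_le_two_mul {ι : Type*} (s : Finset ι) (d : ι → ℝ) {R : ℝ} (hR : 0 < R) :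
    ∑ j ∈ s.filter (fun j => |d j| ≤ 2 * R), 1 / d j ^ 2 ≤
      ∑ j ∈ s.filter (fun j => |d j| ≤ R), 1 / d j ^ 2 +
        (s.filter (fun j => |d j| ≤ 2 * R)).card * (1 / R ^ 2) := by
  rw [← nsmul_eq_mul, ← Finset.sum_const]
  simp only [Finset.sum_filter]
  rw [← Finset.sum_add_distrib]
  refine Finset.sum_le_sum fun j _ => ?_
  have hRR : 0 ≤ 1 / R ^ 2 := by positivity
  by_cases h₁ : |d j| ≤ R
  · have h₂ : |d j| ≤ 2 * R := by linarith
    simpa only [if_pos h₁, if_pos h₂] using le_add_of_nonneg_right hRR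
  · rw [if_neg h₁, zero_add]
    split_ifs
    · rw [← sq_abs (d j)]
      have := (not_le.mp h₁).le
      gcongr
    · exact le_rfl

/-- The dyadic summation: inverse-square sum over the points within distance `2 ^ K * r`, where
the sum over the innermost ball is at most `A` and balls of radius `R ≥ r` hold at most `B * R`
points. -/
lemma sum_inv_sq_dyadic_le {ι : Type*} (s : Finset ι) (d : ι → ℝ) {r A B : ℝ} (hr : 0 < r)
    (hA : ∑ j ∈ s.filter (fun j => |d j| ≤ r), 1 / d j ^ 2 ≤ A)
    (hB : ∀ R, r ≤ R → ((s.filter (fun j => |d j| ≤ R)).card : ℝ) ≤ B * R) (K : ℕ) :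
    ∑ j ∈ s.filter (fun j => |d j| ≤ 2 ^ K * r), 1 / d j ^ 2 ≤
      A + 4 * B / r * (1 - 1 / 2 ^ K) := by
  induction K with
  | zero => simpa using hA
  | succ K ih =>
    have hstep := sum_inv_sq_le_two_mul s d (R := 2 ^ K * r) (by positivity)
    have hcard := hB (2 * (2 ^ K * r)) (by
      have : (1 : ℝ) ≤ 2 ^ K := one_le_pow₀ one_le_two
      nlinarith)
    have hmul := mul_le_mul_of_nonneg_right hcard
      (by positivity : (0 : ℝ) ≤ 1 / (2 ^ K * r) ^ 2)
    have hcalc : B * (2 * (2 ^ K * r)) * (1 / (2 ^ K * r) ^ 2) =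
        4 * B / r * (1 - 1 / 2 ^ (K + 1)) - 4 * B / r * (1 - 1 / 2 ^ K) := by
      field_simp
      ring
    rw [show (2 : ℝ) ^ (K + 1) * r = 2 * (2 ^ K * r) by ring]
    linarith

/-- **Dyadic estimate (4.5).** Under `(δ, C)`-non-accumulation and a gap lower bound
`|λ_j − λ_i| ≥ θ/N` for all `j ≠ i` (with `0 < θ ≤ 1`), the regularized inverse-gap
functional satisfies `(1/N²)·∑_{j ≠ i} 1/(λ_j − λ_i)² ≤ C'·N^δ·θ^{−2}` with `C'`
depending only on `C` and `δ`. -/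
theorem stmt7 (δ C : ℝ) (hδ : 0 < δ) (hC : 1 ≤ C) :
    ∃ C' : ℝ, 0 < C' ∧
      ∀ N : ℕ, 2 ≤ N →
      ∀ lam : Fin N → ℝ, NonAccum N δ C lam →
      ∀ i : Fin N, ∀ θ : ℝ, 0 < θ → θ ≤ 1 →
        (∀ j : Fin N, j ≠ i → θ / N ≤ |lam j - lam i|) →
        (1 / (N : ℝ) ^ 2) * ∑ j ∈ Finset.univ.filter (· ≠ i), 1 / (lam j - lam i) ^ 2
          ≤ C' * (N : ℝ) ^ δ * θ⁻¹ ^ 2 := by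
  refine ⟨10 * C, by linarith, fun N hN lam hlam i θ hθ hθ1 hgap => ?_⟩
  have hN0 : (0 : ℝ) < N := by positivity
  have hN1 : (1 : ℝ) ≤ N := by exact_mod_cast (by omega : 1 ≤ N)
  obtain ⟨L, hL⟩ : ∃ L, L = (N : ℝ) ^ δ := ⟨_, rfl⟩
  have hL1 : 1 ≤ L := hL ▸ Real.one_le_rpow hN1 hδ.le
  have hr : (N : ℝ) ^ (-1 + δ) = L / N := by
    rw [Real.rpow_add hN0, Real.rpow_neg_one, hL]
    ring
  have hcount : ∀ R, L / N ≤ R →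
      (((Finset.univ.filter (· ≠ i)).filter (fun j => |lam j - lam i| ≤ R)).card : ℝ) ≤
        2 * C * N * R := by
    intro R hR
    have hcard := hlam.card_le (lam i) (hr.trans_le hR)
    have hsub : (((Finset.univ.filter (· ≠ i)).filter (fun j => |lam j - lam i| ≤ R)).card : ℝ) ≤
        (Finset.univ.filter (fun j => |lam j - lam i| ≤ R)).card := by
      exact_mod_cast Finset.card_le_card
        (Finset.filter_subset_filter _ (Finset.filter_subset _ _))
    linarith
  have hinner : ∑ j ∈ (Finset.univ.filter (· ≠ i)).filter (fun j => |lam j - lam i| ≤ L / N),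
      1 / (lam j - lam i) ^ 2 ≤ 2 * C * N * (L / N) * (1 / (θ / N) ^ 2) := by
    refine (Finset.sum_le_card_nsmul _ _ (1 / (θ / N) ^ 2) fun j hj => ?_).trans ?_
    · have hj' := hgap j (by simpa using (Finset.mem_filter.mp (Finset.mem_filter.mp hj).1).2)
      rw [← sq_abs (lam j - lam i)]
      gcongr
    · rw [nsmul_eq_mul]
      exact mul_le_mul_of_nonneg_right (hcount _ le_rfl) (by positivity)
  have hrpos : 0 < L / N := by positivity
  obtain ⟨K, hK⟩ := pow_unbounded_of_one_lt ((∑ j, |lam j - lam i|) / (L / N)) one_lt_two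
  have hall : (Finset.univ.filter (· ≠ i)).filter
      (fun j => |lam j - lam i| ≤ 2 ^ K * (L / N)) = Finset.univ.filter (· ≠ i) := by
    refine Finset.filter_true_of_mem fun j _ => ?_
    exact (Finset.single_le_sum (f := fun j => |lam j - lam i|) (fun _ _ => abs_nonneg _)
      (Finset.mem_univ j)).trans ((div_lt_iff₀ hrpos).mp hK).le
  have hsum := sum_inv_sq_dyadic_le _ (fun j => lam j - lam i) hrpos hinner hcount K
  rw [hall] at hsum
  have htail : 4 * (2 * C * N) / (L / N) * (1 - 1 / 2 ^ K) ≤ 4 * (2 * C * N) / (L / N) :=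
    mul_le_of_le_one_right (by positivity) (sub_le_self _ (by positivity))
  have hθinv : 1 ≤ θ⁻¹ ^ 2 := one_le_pow₀ ((one_le_inv₀ hθ).mpr hθ1)
  have hLinv : L⁻¹ ≤ L * θ⁻¹ ^ 2 :=
    (inv_le_one_of_one_le₀ hL1).trans (one_le_mul_of_one_le_of_one_le hL1 hθinv)
  rw [← hL]
  calc _ ≤ 1 / (N : ℝ) ^ 2 *
        (2 * C * N * (L / N) * (1 / (θ / N) ^ 2) + 4 * (2 * C * N) / (L / N)) := by
        gcongr
        linarith
    _ = 2 * C * (L * θ⁻¹ ^ 2) + 8 * C * L⁻¹ := by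
        field_simp
        ring
    _ ≤ 2 * C * (L * θ⁻¹ ^ 2) + 8 * C * (L * θ⁻¹ ^ 2) := by gcongr
    _ = 10 * C * L * θ⁻¹ ^ 2 := by ring
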